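/- arXiv:2307.03600 — 3 statements merged into one kernel-verified Lean document; each statement's English description precedes it below -/
import Mathlib

section
/- Fix real numbers λ ≥ 0, s ≥ 0, σ² > 0 and F ∈ ℂ; set μ := s(1+|F|²), and let C be the 2×2 complex matrix with entries C₁₁ = sλ + σ², C₁₂ = s·conj(F)·λ, C₂₁ = sFλ, C₂₂ = s|F|²λ + σ². Let D be the 2×2 matrix D := λ • !![1, conj(F); F, |F|²]. Then Tr[ C⁻¹ * D * C⁻¹ * D ] = (1+|F|²)² λ² / (μλ + σ²)². (This is the Fisher-information trace for the parameter σ_h², i.e., the (2,2) entry of the per-eigenmode Fisher information matrix.) -/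
open Matrix

theorem stmt_17 (l s σ2 : ℝ) (hl : 0 ≤ l) (hs : 0 ≤ s) (hσ2 : 0 < σ2) (F : ℂ)
    (μ : ℝ) (hμ : μ = s * (1 + ‖F‖^2))
    (C : Matrix (Fin 2) (Fin 2) ℂ)
    (hC : C = !![((s * l + σ2 : ℝ) : ℂ), ((s * l : ℝ) : ℂ) * (starRingEnd ℂ F);
                 ((s * l : ℝ) : ℂ) * F, ((s * ‖F‖^2 * l + σ2 : ℝ) : ℂ)])
    (D : Matrix (Fin 2) (Fin 2) ℂ)
    (hD : D = ((l : ℝ) : ℂ) • !![1, starRingEnd ℂ F; F, ((‖F‖^2 : ℝ) : ℂ)]) :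
    Matrix.trace (C⁻¹ * D * C⁻¹ * D)
      = (((1 + ‖F‖^2)^2 * l^2 / (μ * l + σ2)^2 : ℝ) : ℂ) := by
  have hF : F * starRingEnd ℂ F = (‖F‖ : ℂ) ^ 2 := Complex.mul_conj' F
  have hpos : 0 < μ * l + σ2 := by rw [hμ]; positivity
  have hne : ((μ * l + σ2 : ℝ) : ℂ) ≠ 0 := Complex.ofReal_ne_zero.mpr hpos.ne'
  have hdet : C.det = ((σ2 * (μ * l + σ2) : ℝ) : ℂ) := by
    rw [hC, det_fin_two_of, hμ]
    push_cast
    linear_combination (-(s * l : ℂ) ^ 2) * hF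
  have hunit : IsUnit C.det := by
    rw [hdet, isUnit_iff_ne_zero]
    exact Complex.ofReal_ne_zero.mpr (mul_pos hσ2 hpos).ne'
  have hCD : C * D = ((μ * l + σ2 : ℝ) : ℂ) • D := by
    rw [hC, hD, hμ]
    ext i j
    fin_cases i <;> fin_cases j <;> simp [mul_apply, Fin.sum_univ_two]
    · linear_combination (s * l ^ 2 : ℂ) * hF
    · ring
    · ring
    · linear_combination (s * l ^ 2 : ℂ) * hF
  have hDD : (D * D).trace = (((1 + ‖F‖ ^ 2) ^ 2 * l ^ 2 : ℝ) : ℂ) := by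
    rw [hD]
    simp [trace_fin_two]
    linear_combination (2 * l ^ 2 : ℂ) * hF
  have hinv : C⁻¹ * D = ((μ * l + σ2 : ℝ) : ℂ)⁻¹ • D := by
    rw [eq_inv_smul_iff₀ hne, ← mul_smul_comm, ← hCD, nonsing_inv_mul_cancel_left _ _ hunit]
  rw [mul_assoc, hinv, smul_mul_smul_comm, trace_smul, hDD, smul_eq_mul, Complex.ofReal_div,
    Complex.ofReal_pow (μ * l + σ2)]
  field_simp
end

section
/- Fix real numbers λ ≥ 0, s ≥ 0, σ² > 0 and F ∈ ℂ; set μ := s(1+|F|²), and let C be the 2×2 complex matrix with entries C₁₁ = sλ + σ², C₁₂ = s·conj(F)·λ, C₂₁ = sFλ, C₂₂ = s|F|²λ + σ². Let A := s·λ • !![0, 1; 0, F] (the Wirtinger derivative ∂C/∂F*) and B := s·λ • !![0, 0; 1, conj(F)] (the Wirtinger derivative ∂C/∂F). Then Tr[ C⁻¹ * A * C⁻¹ * B ] = ( (1+|F|²) λ² / (μλ + σ²)² ) · s² · ( λ s / σ² + 1 ). (This is the (1,1), i.e., F-F, entry of the per-eigenmode Fisher information matrix.) -/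
open Matrix

theorem stmt_18 (l s σ2 : ℝ) (hl : 0 ≤ l) (hs : 0 ≤ s) (hσ2 : 0 < σ2) (F : ℂ)
    (μ : ℝ) (hμ : μ = s * (1 + ‖F‖^2))
    (C : Matrix (Fin 2) (Fin 2) ℂ)
    (hC : C = !![((s * l + σ2 : ℝ) : ℂ), ((s * l : ℝ) : ℂ) * (starRingEnd ℂ F);
                 ((s * l : ℝ) : ℂ) * F, ((s * ‖F‖^2 * l + σ2 : ℝ) : ℂ)])
    (A B : Matrix (Fin 2) (Fin 2) ℂ)
    (hA : A = ((s * l : ℝ) : ℂ) • !![0, 1; 0, F])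
    (hB : B = ((s * l : ℝ) : ℂ) • !![0, 0; 1, starRingEnd ℂ F]) :
    Matrix.trace (C⁻¹ * A * C⁻¹ * B)
      = (((1 + ‖F‖^2) * l^2 / (μ * l + σ2)^2 * s^2 * (l * s / σ2 + 1) : ℝ) : ℂ) := by
  have hd : 0 < μ * l + σ2 := by
    rw [hμ]; positivity
  have hF : F * starRingEnd ℂ F = ((‖F‖ : ℝ) : ℂ) ^ 2 := Complex.mul_conj' F
  have hd' : (μ : ℂ) * l + σ2 ≠ 0 := by exact_mod_cast hd.ne'
  have hσ' : (σ2 : ℂ) ≠ 0 := by exact_mod_cast hσ2.ne'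
  have hμ' : (μ : ℂ) = s * (1 + F * starRingEnd ℂ F) := by
    rw [hF, hμ]; push_cast; ring
  have hdet : C.det = σ2 * (μ * l + σ2) := by
    rw [hC, Matrix.det_fin_two_of, hμ']
    push_cast
    rw [← hF]
    ring
  have hinv : C⁻¹ = ((σ2 : ℂ) * (μ * l + σ2))⁻¹ • C.adjugate := by
    rw [Matrix.inv_def, hdet, Ring.inverse_eq_inv']
  rw [hinv, hC, Matrix.adjugate_fin_two_of, hA, hB]
  simp only [Matrix.smul_mul, Matrix.mul_smul, Matrix.trace_smul, smul_eq_mul,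
    Matrix.mul_fin_two, Matrix.trace_fin_two_of]
  push_cast
  rw [← hF]
  field_simp
  rw [hμ']
  ring
end

section
/- Fix real numbers λ ≥ 0, s ≥ 0, σ² > 0 and F ∈ ℂ; set μ := s(1+|F|²), and let C be the 2×2 complex matrix with entries C₁₁ = sλ + σ², C₁₂ = s·conj(F)·λ, C₂₁ = sFλ, C₂₂ = s|F|²λ + σ². Let A := s·λ • !![0, 1; 0, F] (the Wirtinger derivative ∂C/∂F*) and D := λ • !![1, conj(F); F, |F|²] (the derivative ∂C/∂s). Then Tr[ C⁻¹ * A * C⁻¹ * D ] = ( (1+|F|²) λ² / (μλ + σ²)² ) · F · s. (This is the (1,2) entry of the per-eigenmode Fisher information matrix.) -/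
open Matrix

/-- An invertible matrix acting on `B` as a nonzero scalar has its inverse acting as the inverse
scalar. -/
lemma Matrix.inv_mul_eq_inv_smul {n p K : Type*} [Fintype n] [DecidableEq n] [Field K]
    {C : Matrix n n K} {B : Matrix n p K} {m : K} (hdet : C.det ≠ 0) (hm : m ≠ 0)
    (h : C * B = m • B) : C⁻¹ * B = m⁻¹ • B := by
  rw [eq_inv_smul_iff₀ hm, ← Matrix.mul_smul, ← h,
    Matrix.nonsing_inv_mul_cancel_left _ _ hdet.isUnit]

theorem stmt_19 (l s σ2 : ℝ) (hl : 0 ≤ l) (hs : 0 ≤ s) (hσ2 : 0 < σ2) (F : ℂ)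
    (μ : ℝ) (hμ : μ = s * (1 + ‖F‖^2))
    (C : Matrix (Fin 2) (Fin 2) ℂ)
    (hC : C = !![((s * l + σ2 : ℝ) : ℂ), ((s * l : ℝ) : ℂ) * (starRingEnd ℂ F);
                 ((s * l : ℝ) : ℂ) * F, ((s * ‖F‖^2 * l + σ2 : ℝ) : ℂ)])
    (A D : Matrix (Fin 2) (Fin 2) ℂ)
    (hA : A = ((s * l : ℝ) : ℂ) • !![0, 1; 0, F])
    (hD : D = ((l : ℝ) : ℂ) • !![1, starRingEnd ℂ F; F, ((‖F‖^2 : ℝ) : ℂ)]) :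
    Matrix.trace (C⁻¹ * A * C⁻¹ * D)
      = (((1 + ‖F‖^2) * l^2 / (μ * l + σ2)^2 * s : ℝ) : ℂ) * F := by
  have hF : (‖F‖ : ℂ) ^ 2 = F * starRingEnd ℂ F := (Complex.mul_conj' F).symm
  have hpos : 0 < μ * l + σ2 := by rw [hμ]; positivity
  have hm : ((μ * l + σ2 : ℝ) : ℂ) ≠ 0 := by exact_mod_cast hpos.ne'
  have hdet : C.det ≠ 0 := by
    have : C.det = ((σ2 * (μ * l + σ2) : ℝ) : ℂ) := by
      rw [hC, Matrix.det_fin_two_of, hμ]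
      push_cast
      rw [hF]
      ring
    rw [this]
    exact_mod_cast (mul_pos hσ2 hpos).ne'
  have hCA : C * A = ((μ * l + σ2 : ℝ) : ℂ) • A := by
    rw [hC, hA, hμ]
    ext i j
    fin_cases i <;> fin_cases j <;> simp [Matrix.mul_apply, Fin.sum_univ_two, hF] <;> ring
  have hCD : C * D = ((μ * l + σ2 : ℝ) : ℂ) • D := by
    rw [hC, hD, hμ]
    ext i j
    fin_cases i <;> fin_cases j <;> simp [Matrix.mul_apply, Fin.sum_univ_two, hF] <;> ring
  have htr : (A * D).trace = (((1 + ‖F‖^2) * l^2 * s : ℝ) : ℂ) * F := by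
    rw [hA, hD]
    simp [Matrix.trace_fin_two, hF]
    ring
  rw [Matrix.mul_assoc _ C⁻¹ D, Matrix.inv_mul_eq_inv_smul hdet hm hCA,
    Matrix.inv_mul_eq_inv_smul hdet hm hCD, Matrix.smul_mul, Matrix.mul_smul, Matrix.trace_smul,
    Matrix.trace_smul, htr, smul_eq_mul, smul_eq_mul]
  push_cast at hm ⊢
  field_simp
end
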